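/- Correctness of the repair-checking reduction from 3SAT (main claim in the proof of the coNP-hardness Corollary for repair checking under universal constraints): With the instance I_Φ and the conflict set C constructed from the 3CNF formula Φ as described (the case of no universally quantified variables), the formula Φ is unsatisfiable if and only if the instance I'_Φ = { r, q₁,…,q_k } is a repair of I_Φ. -/

import Mathlib

/-!
Construction from a 3CNF formula `Φ = C₁ ∧ … ∧ C_k` over variables `x₁,…,x_m`.
A literal is a pair `(i, s) : Fin m × Bool` (`s = true` for `xᵢ`, `s = false` for
`¬xᵢ`); the clauses are given by `Cl : Fin k → Fin 3 → Fin m × Bool`.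
Facts are `pᵢ = pv i true`, `p̄ᵢ = pv i false`, `qⱼ`, `r`, and `r̄`.
-/

/-- The type of facts of the reduction (`m` variables, `k` clauses). -/
abbrev SFact (m k : ℕ) : Type := (Fin m × Bool) ⊕ (Fin k ⊕ Bool)

/-- `pv i true = pᵢ` and `pv i false = p̄ᵢ`. -/
def pv {m k : ℕ} (i : Fin m) (s : Bool) : SFact m k := Sum.inl (i, s)

/-- `ℓ(L)`: the fact corresponding to the satisfying valuation of the literal `L`. -/
def litf {m k : ℕ} (L : Fin m × Bool) : SFact m k := Sum.inl L

/-- The fact `qⱼ` for the clause `Cⱼ`. -/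
def qc {m k : ℕ} (j : Fin k) : SFact m k := Sum.inr (Sum.inl j)

/-- The special fact `r`. -/
def rpos {m k : ℕ} : SFact m k := Sum.inr (Sum.inr true)

/-- The special fact `r̄`. -/
def rbar {m k : ℕ} : SFact m k := Sum.inr (Sum.inr false)

variable {F : Type*} [DecidableEq F]

/-- An instance `J` is consistent: no conflict `(P,N) ∈ C` has `P ⊆ J` and `N ∩ J = ∅`. -/
def CConsistent (C : Set (Finset F × Finset F)) (J : Finset F) : Prop :=
  ¬ ∃ c ∈ C, c.1 ⊆ J ∧ c.2 ∩ J = ∅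

/-- Symmetric difference `Δ(I,J) = (I∖J) ∪ (J∖I)` of two instances. -/
def CDelta (I J : Finset F) : Finset F := (I \ J) ∪ (J \ I)

/-- `I'` is a repair of `I`: a consistent instance such that no consistent instance `J`
satisfies `Δ(I,J) ⊊ Δ(I,I')`. -/
def CRepair (C : Set (Finset F × Finset F)) (I I' : Finset F) : Prop :=
  CConsistent C I' ∧ ¬ ∃ J : Finset F, CConsistent C J ∧ CDelta I J ⊂ CDelta I I'

/-- The conflict set of the reduction: `({pᵢ,p̄ᵢ},∅)` for every `i`; `({r,r̄},∅)`;
`({pᵢ,r},∅)` and `({p̄ᵢ,r},∅)` for every `i`; and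
`({qⱼ}, {ℓ(Lⱼ₁), ℓ(Lⱼ₂), ℓ(Lⱼ₃), r})` for every clause `Cⱼ`. -/
def CPhi (m k : ℕ) (Cl : Fin k → Fin 3 → Fin m × Bool) :
    Set (Finset (SFact m k) × Finset (SFact m k)) :=
  {c | (∃ i : Fin m, c = ({pv i true, pv i false}, ∅)) ∨
       c = ({rpos, rbar}, ∅) ∨
       (∃ i : Fin m, c = ({pv i true, rpos}, ∅) ∨ c = ({pv i false, rpos}, ∅)) ∨
       (∃ j : Fin k,
          c = ({qc j}, {litf (Cl j 0), litf (Cl j 1), litf (Cl j 2), rpos}))}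

/-- The instance `I_Φ = { pᵢ, p̄ᵢ : 1 ≤ i ≤ m } ∪ { q₁,…,q_k } ∪ { r̄ }`. -/
def IPhi (m k : ℕ) : Finset (SFact m k) :=
  (Finset.univ.image fun x : Fin m × Bool => (litf x : SFact m k))
  ∪ (Finset.univ.image fun j : Fin k => (qc j : SFact m k)) ∪ {rbar}

/-- The candidate repair `I'_Φ = { r, q₁,…,q_k }`. -/
def IPhi' (m k : ℕ) : Finset (SFact m k) :=
  {rpos} ∪ (Finset.univ.image fun j : Fin k => (qc j : SFact m k))

/-- Consistency with respect to `CPhi`, spelled out conflict by conflict. -/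
theorem cconsistent_cPhi_iff {m k : ℕ} (Cl : Fin k → Fin 3 → Fin m × Bool)
    (J : Finset (SFact m k)) :
    CConsistent (CPhi m k Cl) J ↔
      (∀ i, ¬ (pv i true ∈ J ∧ pv i false ∈ J)) ∧ ¬ (rpos ∈ J ∧ rbar ∈ J) ∧
      (∀ i s, ¬ (pv i s ∈ J ∧ rpos ∈ J)) ∧
      (∀ j, qc j ∈ J → (∃ t, litf (Cl j t) ∈ J) ∨ rpos ∈ J) := by
  have hq (j : Fin k) : ({litf (Cl j 0), litf (Cl j 1), litf (Cl j 2), rpos} :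
      Finset (SFact m k)) ∩ J = ∅ ↔ ¬ ((∃ t, litf (Cl j t) ∈ J) ∨ rpos ∈ J) := by
    simp only [← Finset.disjoint_iff_inter_eq_empty, Finset.disjoint_insert_left,
      Finset.disjoint_singleton_left, Fin.exists_fin_succ]
    simp
    tauto
  constructor
  · intro h
    refine ⟨fun i hi => h ⟨_, Or.inl ⟨i, rfl⟩, ?_⟩, fun hr => h ⟨_, Or.inr (Or.inl rfl), ?_⟩,
      fun i s hi => ?_, fun j hj => ?_⟩
    · simpa [Finset.insert_subset_iff] using hi
    · simpa [Finset.insert_subset_iff] using hr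
    · cases s
      · exact h ⟨_, Or.inr (Or.inr (Or.inl ⟨i, Or.inr rfl⟩)),
          by simpa [Finset.insert_subset_iff] using hi⟩
      · exact h ⟨_, Or.inr (Or.inr (Or.inl ⟨i, Or.inl rfl⟩)),
          by simpa [Finset.insert_subset_iff] using hi⟩
    · by_contra hn
      exact h ⟨_, Or.inr (Or.inr (Or.inr ⟨j, rfl⟩)), by simpa using hj, (hq j).2 hn⟩
  · rintro ⟨h₁, h₂, h₃, h₄⟩ ⟨c, (⟨i, rfl⟩ | rfl | ⟨i, rfl | rfl⟩ | ⟨j, rfl⟩), hP, hN⟩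
    · exact h₁ i (by simpa [Finset.insert_subset_iff] using hP)
    · exact h₂ (by simpa [Finset.insert_subset_iff] using hP)
    · exact h₃ i true (by simpa [Finset.insert_subset_iff] using hP)
    · exact h₃ i false (by simpa [Finset.insert_subset_iff] using hP)
    · exact (hq j).1 hN (h₄ j (by simpa using hP))

theorem cconsistent_iPhi' {m k : ℕ} (Cl : Fin k → Fin 3 → Fin m × Bool) :
    CConsistent (CPhi m k Cl) (IPhi' m k) := by
  rw [cconsistent_cPhi_iff]
  simp [IPhi', pv, litf, qc, rpos, rbar]

/-- A fact belongs to `Δ(I_Φ, I'_Φ)` unless it is some `qⱼ`. -/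
theorem mem_cDelta_iPhi_iPhi' {m k : ℕ} (f : SFact m k) :
    f ∈ CDelta (IPhi m k) (IPhi' m k) ↔ ∀ j, f ≠ qc j := by
  rcases f with ⟨i, s⟩ | j | _ | _ <;>
    simp [CDelta, IPhi, IPhi', litf, qc, rpos, rbar]

/-- `Δ(I_Φ, J)` consists of `r` if `r ∈ J`, and of the other facts missing from `J`. -/
theorem mem_cDelta_iPhi {m k : ℕ} (J : Finset (SFact m k)) (f : SFact m k) :
    f ∈ CDelta (IPhi m k) J ↔ (f = rpos ↔ f ∈ J) := by
  rcases f with ⟨i, s⟩ | j | _ | _ <;>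
    simp [CDelta, IPhi, litf, qc, rpos, rbar]

/-- The instance `{ℓ(L) : L true under v} ∪ {q₁,…,q_k} ∪ {r̄}` of a valuation `v`. -/
def valuationInstance {m : ℕ} (k : ℕ) (v : Fin m → Bool) : Finset (SFact m k) :=
  (Finset.univ.image fun i => (pv i (v i) : SFact m k))
  ∪ (Finset.univ.image fun j : Fin k => (qc j : SFact m k)) ∪ {rbar}

theorem cconsistent_valuationInstance {m k : ℕ} {Cl : Fin k → Fin 3 → Fin m × Bool}
    {v : Fin m → Bool} (hv : ∀ j, ∃ t, v (Cl j t).1 = (Cl j t).2) :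
    CConsistent (CPhi m k Cl) (valuationInstance k v) := by
  rw [cconsistent_cPhi_iff]
  simpa [valuationInstance, pv, litf, qc, rpos, rbar, Prod.ext_iff] using hv

theorem cDelta_valuationInstance_ssubset {m k : ℕ} (v : Fin m → Bool) :
    CDelta (IPhi m k) (valuationInstance k v) ⊂ CDelta (IPhi m k) (IPhi' m k) := by
  refine Finset.ssubset_iff_subset_ne.2 ⟨fun f hf => ?_, fun h => ?_⟩
  · rw [mem_cDelta_iPhi_iPhi']
    rintro j rfl
    simp [mem_cDelta_iPhi, valuationInstance, qc, rpos] at hf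
  · have := congrArg (rpos ∈ ·) h
    simp [mem_cDelta_iPhi, valuationInstance, IPhi', pv, qc, rpos, rbar] at this

/-- A consistent instance strictly closer to `I_Φ` than `I'_Φ` yields a satisfying valuation. -/
theorem exists_valuation_of_cDelta_ssubset {m k : ℕ} {Cl : Fin k → Fin 3 → Fin m × Bool}
    {J : Finset (SFact m k)} (hJ : CConsistent (CPhi m k Cl) J)
    (hlt : CDelta (IPhi m k) J ⊂ CDelta (IPhi m k) (IPhi' m k)) :
    ∃ v : Fin m → Bool, ∀ j, ∃ t, v (Cl j t).1 = (Cl j t).2 := by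
  obtain ⟨hp, hr, hpr, hq⟩ := (cconsistent_cPhi_iff Cl J).1 hJ
  have hqJ (j : Fin k) : qc j ∈ J := by
    by_contra hj
    exact (mem_cDelta_iPhi_iPhi' _).1
      (hlt.1 ((mem_cDelta_iPhi J (qc j)).2 ⟨nofun, fun h => (hj h).elim⟩)) j rfl
  have hrJ : rpos ∉ J := by
    intro hrJ
    refine hlt.2 fun f hf => (mem_cDelta_iPhi J f).2 ?_
    rw [mem_cDelta_iPhi_iPhi'] at hf
    rcases f with ⟨i, s⟩ | j | _ | _
    · exact ⟨nofun, fun h => (hpr i s ⟨h, hrJ⟩).elim⟩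
    · exact (hf j rfl).elim
    · exact ⟨nofun, fun h => (hr ⟨hrJ, h⟩).elim⟩
    · exact ⟨fun _ => hrJ, fun _ => rfl⟩
  refine ⟨fun i => decide (pv i true ∈ J), fun j => ?_⟩
  obtain ⟨t, ht⟩ := (hq j (hqJ j)).resolve_right hrJ
  refine ⟨t, ?_⟩
  rcases hL : Cl j t with ⟨i, _ | _⟩ <;> rw [hL] at ht
  · exact decide_eq_false fun h => hp i ⟨h, ht⟩
  · exact decide_eq_true ht

/-- Correctness of the repair-checking reduction from 3SAT: `Φ` is unsatisfiable iff
`I'_Φ = { r, q₁,…,q_k }` is a repair of `I_Φ`. -/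
theorem threesat_repair_checking_reduction (m k : ℕ)
    (Cl : Fin k → Fin 3 → Fin m × Bool) :
    (¬ ∃ v : Fin m → Bool, ∀ j : Fin k, ∃ t : Fin 3, v (Cl j t).1 = (Cl j t).2) ↔
      CRepair (CPhi m k Cl) (IPhi m k) (IPhi' m k) := by
  refine ⟨fun h => ⟨cconsistent_iPhi' Cl, ?_⟩, ?_⟩
  · rintro ⟨J, hJ, hlt⟩
    exact h (exists_valuation_of_cDelta_ssubset hJ hlt)
  · rintro ⟨-, h⟩ ⟨v, hv⟩
    exact h ⟨_, cconsistent_valuationInstance hv, cDelta_valuationInstance_ssubset v⟩
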